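/- Let q be a complex number with |q| < 1 and let a be a complex number with 1 + a q^{2N+1} ≠ 0 for every positive integer N. Then ∑_{n=0}^{∞} a^n q^{n²+n} / (q; q)_n = (−a q³; q²)_∞ · ∑_{n=0}^{∞} a^n q^{n²+n} / ((q²; q²)_n · (−a q³; q²)_n). -/

import Mathlib

/-- The finite q-Pochhammer symbol `(a; q)_n = ∏_{j=0}^{n-1} (1 - a q^j)`. -/
noncomputable def qPoch (a q : ℂ) (n : ℕ) : ℂ := ∏ j ∈ Finset.range n, (1 - a * q ^ j)

/-- The infinite q-Pochhammer symbol `(a; q)_∞ = ∏_{j=0}^{∞} (1 - a q^j)`. -/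
noncomputable def qPochInf (a q : ℂ) : ℂ := ∏' j : ℕ, (1 - a * q ^ j)

theorem qPoch_succ (a q : ℂ) (n : ℕ) : qPoch a q (n + 1) = qPoch a q n * (1 - a * q ^ n) :=
  Finset.prod_range_succ _ _

theorem one_sub_pow_succ_ne_zero {q : ℂ} (hq : ‖q‖ < 1) (n : ℕ) : 1 - q ^ (n + 1) ≠ 0 := by
  intro h
  have h1 : ‖q ^ (n + 1)‖ < 1 := by
    rw [norm_pow]
    exact pow_lt_one₀ (norm_nonneg _) hq (Nat.succ_ne_zero n)
  rw [← sub_eq_zero.mp h, norm_one] at h1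
  exact lt_irrefl _ h1

theorem qPoch_self_ne_zero {q : ℂ} (hq : ‖q‖ < 1) (n : ℕ) : qPoch q q n ≠ 0 := by
  refine Finset.prod_ne_zero_iff.mpr fun j _ => ?_
  rw [← pow_succ']
  exact one_sub_pow_succ_ne_zero hq j

theorem one_sub_pow_succ_mul_inv_qPoch_succ {q : ℂ} (hq : ‖q‖ < 1) (n : ℕ) :
    (1 - q ^ (n + 1)) * (qPoch q q (n + 1))⁻¹ = (qPoch q q n)⁻¹ := by
  have h1 := one_sub_pow_succ_ne_zero hq n
  have h2 := qPoch_self_ne_zero hq n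
  rw [qPoch_succ, ← pow_succ']
  field_simp

theorem norm_sq_lt_one {q : ℂ} (hq : ‖q‖ < 1) : ‖q ^ 2‖ < 1 := by
  rw [norm_pow]
  exact pow_lt_one₀ (norm_nonneg _) hq two_ne_zero

/-- The term of Euler's series for `(-xq; q²)_∞`. -/
noncomputable def eulerTerm (q x : ℂ) (k : ℕ) : ℂ :=
  x ^ k * q ^ k ^ 2 * (qPoch (q ^ 2) (q ^ 2) k)⁻¹

theorem one_sub_mul_eulerTerm_succ {q : ℂ} (hq : ‖q‖ < 1) (x : ℂ) (k : ℕ) :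
    (1 - (q ^ 2) ^ (k + 1)) * eulerTerm q x (k + 1) =
      x * q * (q ^ 2) ^ k * eulerTerm q x k := by
  have h := one_sub_pow_succ_mul_inv_qPoch_succ (norm_sq_lt_one hq) k
  unfold eulerTerm
  rw [← h]
  ring

theorem summable_norm_eulerTerm {q : ℂ} (hq : ‖q‖ < 1) (x : ℂ) :
    Summable fun k => ‖eulerTerm q x k‖ := by
  have hp := norm_sq_lt_one hq
  have h0 : Filter.Tendsto (fun k : ℕ => (q ^ 2) ^ k) Filter.atTop (nhds 0) :=
    tendsto_pow_atTop_nhds_zero_of_norm_lt_one hp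
  have h1 : Filter.Tendsto (fun k : ℕ => x * q * (q ^ 2) ^ k / (1 - (q ^ 2) ^ (k + 1)))
      Filter.atTop (nhds 0) := by
    have := (h0.const_mul (x * q)).div
      ((h0.comp (Filter.tendsto_add_atTop_nat 1)).const_sub 1) (by simp)
    simpa [Pi.div_def] using this
  have h2 := h1.norm.eventually_le_const (u := (1 / 2 : ℝ)) (by simp)
  refine summable_of_ratio_norm_eventually_le (r := 1 / 2) (by norm_num) ?_
  filter_upwards [h2] with k hk
  have h3 : eulerTerm q x (k + 1) =
      x * q * (q ^ 2) ^ k / (1 - (q ^ 2) ^ (k + 1)) * eulerTerm q x k := by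
    have := one_sub_pow_succ_ne_zero hp k
    rw [div_mul_eq_mul_div, eq_div_iff this, ← one_sub_mul_eulerTerm_succ hq, mul_comm]
  rw [norm_norm, norm_norm, h3, norm_mul]
  exact mul_le_mul_of_nonneg_right hk (norm_nonneg _)

theorem eulerTerm_mul_pow (q x y : ℂ) (k : ℕ) :
    eulerTerm q (x * y) k = y ^ k * eulerTerm q x k := by
  unfold eulerTerm
  ring

theorem tsum_eulerTerm_step {q : ℂ} (hq : ‖q‖ < 1) (x : ℂ) :
    ∑' k, eulerTerm q x k = (1 + x * q) * ∑' k, eulerTerm q (x * q ^ 2) k := by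
  have hs := (summable_norm_eulerTerm hq x).of_norm
  have hs' := (summable_norm_eulerTerm hq (x * q ^ 2)).of_norm
  have h : ∑' k, (eulerTerm q x k - eulerTerm q (x * q ^ 2) k) =
      x * q * ∑' k, eulerTerm q (x * q ^ 2) k := by
    rw [(hs.sub hs').tsum_eq_zero_add, ← tsum_mul_left]
    have h0 : eulerTerm q x 0 - eulerTerm q (x * q ^ 2) 0 = 0 := by simp [eulerTerm]
    rw [h0, zero_add]
    refine tsum_congr fun k => ?_
    rw [eulerTerm_mul_pow, eulerTerm_mul_pow]
    linear_combination one_sub_mul_eulerTerm_succ hq x k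
  rw [hs.tsum_sub hs'] at h
  linear_combination h

theorem tsum_eulerTerm_eq_qPoch_mul {q : ℂ} (hq : ‖q‖ < 1) (x : ℂ) (n : ℕ) :
    ∑' k, eulerTerm q x k =
      qPoch (-(x * q)) (q ^ 2) n * ∑' k, eulerTerm q (x * (q ^ 2) ^ n) k := by
  induction n with
  | zero => simp [qPoch]
  | succ n ih =>
    rw [ih, tsum_eulerTerm_step hq (x * (q ^ 2) ^ n), qPoch_succ, pow_succ (q ^ 2) n, ← mul_assoc x]
    ring

/-- Euler's expansion of `(-xq; q²)_∞`. -/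
theorem qPochInf_eq_tsum_eulerTerm {q : ℂ} (hq : ‖q‖ < 1) (x : ℂ) :
    qPochInf (-(x * q)) (q ^ 2) = ∑' k, eulerTerm q x k := by
  have hp := norm_sq_lt_one hq
  have hm : Multipliable fun j : ℕ => 1 - -(x * q) * (q ^ 2) ^ j := by
    simp_rw [sub_eq_add_neg]
    refine multipliable_one_add_of_summable ?_
    simp_rw [norm_neg, norm_mul _ ((q ^ 2) ^ _), norm_pow (q ^ 2)]
    exact (summable_geometric_of_lt_one (norm_nonneg _) hp).mul_left _
  have h1 : Filter.Tendsto (fun n => qPoch (-(x * q)) (q ^ 2) n) Filter.atTop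
      (nhds (qPochInf (-(x * q)) (q ^ 2))) := hm.hasProd.tendsto_prod_nat
  have h2 : Filter.Tendsto (fun n : ℕ => ∑' k, eulerTerm q (x * (q ^ 2) ^ n) k) Filter.atTop
      (nhds (∑' k, eulerTerm q 0 k)) := by
    refine tendsto_tsum_of_dominated_convergence (summable_norm_eulerTerm hq x) ?_ ?_
    · intro k
      have hc : Continuous fun y => eulerTerm q y k := by
        unfold eulerTerm
        fun_prop
      have := (tendsto_pow_atTop_nhds_zero_of_norm_lt_one hp).const_mul x
      rw [mul_zero] at this
      exact (hc.tendsto 0).comp this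
    · refine Filter.Eventually.of_forall fun n k => ?_
      rw [eulerTerm_mul_pow, norm_mul, norm_pow, norm_pow]
      exact mul_le_of_le_one_left (norm_nonneg _)
        (pow_le_one₀ (by positivity) (pow_le_one₀ (norm_nonneg _) hp.le))
  have h3 : ∑' k, eulerTerm q 0 k = 1 := by
    rw [tsum_eq_single 0 fun k hk => by simp [eulerTerm, hk]]
    simp [eulerTerm, qPoch]
  rw [h3] at h2
  have h4 := h1.mul h2
  simp_rw [← tsum_eulerTerm_eq_qPoch_mul hq x, mul_one] at h4
  exact tendsto_nhds_unique h4 tendsto_const_nhds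

/-- The coefficient form of `1 / ((z; q²)_∞ (zq; q²)_∞) = 1 / (z; q)_∞`. -/
theorem sum_antidiagonal_inv_qPoch_sq {q : ℂ} (hq : ‖q‖ < 1) (N : ℕ) :
    ∑ ij ∈ Finset.HasAntidiagonal.antidiagonal N, q ^ ij.2 * (qPoch (q ^ 2) (q ^ 2) ij.1)⁻¹ *
      (qPoch (q ^ 2) (q ^ 2) ij.2)⁻¹ = (qPoch q q N)⁻¹ := by
  induction N with
  | zero => simp [qPoch]
  | succ N ih =>
    refine mul_left_cancel₀ (one_sub_pow_succ_ne_zero hq N) ?_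
    rw [one_sub_pow_succ_mul_inv_qPoch_succ hq, ← ih, sub_mul, one_mul]
    nth_rw 2 [← Finset.Nat.sum_antidiagonal_swap]
    rw [Finset.mul_sum, ← Finset.sum_sub_distrib]
    have h : ∀ ij ∈ Finset.HasAntidiagonal.antidiagonal (N + 1),
        q ^ ij.2 * (qPoch (q ^ 2) (q ^ 2) ij.1)⁻¹ * (qPoch (q ^ 2) (q ^ 2) ij.2)⁻¹ -
          q ^ (N + 1) * (q ^ ij.swap.2 * (qPoch (q ^ 2) (q ^ 2) ij.swap.1)⁻¹ *
            (qPoch (q ^ 2) (q ^ 2) ij.swap.2)⁻¹) =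
        q ^ ij.2 * ((1 - (q ^ 2) ^ ij.1) * (qPoch (q ^ 2) (q ^ 2) ij.1)⁻¹) *
          (qPoch (q ^ 2) (q ^ 2) ij.2)⁻¹ := by
      intro ij hij
      rw [← Finset.HasAntidiagonal.mem_antidiagonal.mp hij, Prod.fst_swap, Prod.snd_swap]
      ring
    rw [Finset.sum_congr rfl h, Finset.Nat.sum_antidiagonal_succ]
    simp [one_sub_pow_succ_mul_inv_qPoch_succ (norm_sq_lt_one hq)]

/-- second identity of Entry 1.5.1: for `|q| < 1` and `a` with
`1 + a q^{2N+1} ≠ 0` for all positive integers `N`,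
`∑_{n≥0} a^n q^{n²+n}/(q; q)_n
  = (−aq³; q²)_∞ ∑_{n≥0} a^n q^{n²+n}/((q²; q²)_n (−aq³; q²)_n)`. -/
theorem entry_1_5_1_second (q a : ℂ) (hq : ‖q‖ < 1)
    (ha : ∀ N : ℕ, 0 < N → 1 + a * q ^ (2 * N + 1) ≠ 0) :
    ∑' n : ℕ, a ^ n * q ^ (n ^ 2 + n) / qPoch q q n =
      qPochInf (-(a * q ^ 3)) (q ^ 2) *
        ∑' n : ℕ, a ^ n * q ^ (n ^ 2 + n) /
          (qPoch (q ^ 2) (q ^ 2) n * qPoch (-(a * q ^ 3)) (q ^ 2) n) := by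
  have hA : -(a * q ^ 3) = -(a * q ^ 2 * q) := by ring
  have hne : ∀ n, qPoch (-(a * q ^ 3)) (q ^ 2) n ≠ 0 := by
    refine fun n => Finset.prod_ne_zero_iff.mpr fun j _ => ?_
    convert ha (j + 1) j.succ_pos using 1
    ring
  set F : ℕ × ℕ → ℂ := fun nk =>
    eulerTerm q (a * q) nk.1 * eulerTerm q (a * q ^ 2 * (q ^ 2) ^ nk.1) nk.2 with hF
  have hsum : Summable F := by
    refine Summable.of_norm_bounded
      ((summable_norm_eulerTerm hq (a * q)).mul_of_nonneg
        (summable_norm_eulerTerm hq (a * q ^ 2)) (fun _ => norm_nonneg _)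
        fun _ => norm_nonneg _) fun nk => ?_
    simp only [hF, norm_mul]
    gcongr
    rw [eulerTerm_mul_pow, norm_mul, norm_pow, norm_pow]
    exact mul_le_of_le_one_left (norm_nonneg _)
      (pow_le_one₀ (by positivity) (pow_le_one₀ (norm_nonneg _) (norm_sq_lt_one hq).le))
  have hR : qPochInf (-(a * q ^ 3)) (q ^ 2) *
        ∑' n : ℕ, a ^ n * q ^ (n ^ 2 + n) /
          (qPoch (q ^ 2) (q ^ 2) n * qPoch (-(a * q ^ 3)) (q ^ 2) n) = ∑' nk, F nk := by
    rw [hsum.tsum_prod, ← tsum_mul_left]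
    refine tsum_congr fun n => ?_
    have h := hne n
    have h' := qPoch_self_ne_zero (norm_sq_lt_one hq) n
    simp only [hF]
    rw [tsum_mul_left, hA, qPochInf_eq_tsum_eulerTerm hq,
      tsum_eulerTerm_eq_qPoch_mul hq (a * q ^ 2) n, ← hA]
    unfold eulerTerm
    field_simp
    ring
  have hsum' : Summable fun c => F (Finset.HasAntidiagonal.sigmaAntidiagonalEquivProd c) :=
    Finset.HasAntidiagonal.sigmaAntidiagonalEquivProd.summable_iff.mpr hsum
  rw [hR, ← Finset.HasAntidiagonal.sigmaAntidiagonalEquivProd.tsum_eq F, hsum'.tsum_sigma]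
  refine tsum_congr fun N => ?_
  rw [tsum_fintype, div_eq_mul_inv, ← sum_antidiagonal_inv_qPoch_sq hq, Finset.mul_sum,
    ← Finset.sum_coe_sort]
  refine Finset.sum_congr rfl fun ij _ => ?_
  obtain ⟨⟨i, j⟩, hij⟩ := ij
  simp only [hF, Finset.HasAntidiagonal.sigmaAntidiagonalEquivProd_apply]
  obtain rfl := Finset.HasAntidiagonal.mem_antidiagonal.mp hij
  unfold eulerTerm
  ring
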